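/- Every reduced noetherian commutative ring is a Rado ring. -/

import Mathlib

open BigOperators

/-- A matrix `A` over `S` is partition regular over the `S`-module `M` for `r` colours if
every colouring of `M` with `r` colours admits a nonzero monochromatic solution of `A m = 0`. -/
def IsPR {S : Type*} [CommRing S] {k l : ℕ} (A : Matrix (Fin k) (Fin l) S)
    (M : Type*) [AddCommGroup M] [Module S M] (r : ℕ) : Prop :=
  ∀ χ : M → Fin r, ∃ m : Fin l → M, m ≠ 0 ∧
    (∀ i, ∑ j, A i j • m j = 0) ∧ ∀ j j', χ (m j) = χ (m j')

/-- Partition regularity for every (positive) finite number of colours. -/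
def IsPRAll {S : Type*} [CommRing S] {k l : ℕ} (A : Matrix (Fin k) (Fin l) S)
    (M : Type*) [AddCommGroup M] [Module S M] : Prop :=
  ∀ r : ℕ, 1 ≤ r → IsPR A M r

/-- The generalised columns condition of Bergelson--Deuber--Hindman--Lefmann. -/
def GenColumnsCondition {R : Type*} [CommRing R] {k l : ℕ}
    (A : Matrix (Fin k) (Fin l) R) : Prop :=
  ∃ (m : ℕ) (I : Fin (m + 1) → Finset (Fin l)) (d : Fin (m + 1) → R),
    (∀ t, (I t).Nonempty) ∧
    (∀ t t', t ≠ t' → Disjoint (I t) (I t')) ∧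
    (∀ j : Fin l, ∃ t, j ∈ I t) ∧
    (∀ t, d t ≠ 0) ∧
    (∀ i : Fin k, d 0 * ∑ j ∈ I 0, A i j = 0) ∧
    (∀ t : Fin (m + 1), 0 < t →
      (fun i : Fin k => d t * ∑ j ∈ I t, A i j) ∈
        Submodule.span R
          ((fun j (i : Fin k) => A i j) '' {j | ∃ t', t' < t ∧ j ∈ I t'})) ∧
    (0 < m → ∀ n : ℕ,
      (Set.range fun r : R =>
        d 0 * (∏ t ∈ Finset.univ.filter (fun t => t ≠ 0), d t) ^ n * r).Infinite)

/-- A ring is a Rado ring if partition regularity over it is equivalent to the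
generalised columns condition, for every matrix. -/
def IsRadoRing (R : Type*) [CommRing R] : Prop :=
  ∀ (k l : ℕ) (A : Matrix (Fin k) (Fin l) R), IsPRAll A R ↔ GenColumnsCondition A


/-- In an infinite group one can choose weights with all nonempty subset sums nonzero. -/
lemma exists_weights {D : Type*} [AddCommGroup D] [Infinite D] {ι : Type*} [DecidableEq ι]
    (T : Finset ι) :
    ∃ g : ι → D, ∀ S : Finset ι, S ⊆ T → S.Nonempty → ∑ i ∈ S, g i ≠ 0 := by
  classical
  induction T using Finset.induction_on with
  | empty =>
    refine ⟨0, fun S hS hne => ?_⟩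
    exact absurd (Finset.subset_empty.1 hS) hne.ne_empty
  | insert a T ha ih =>
    obtain ⟨g, hg⟩ := ih
    obtain ⟨z, hz⟩ := Infinite.exists_notMem_finset (T.powerset.image fun S => - ∑ i ∈ S, g i)
    refine ⟨Function.update g a z, fun S hS hne => ?_⟩
    by_cases haS : a ∈ S
    · rw [← Finset.insert_erase haS, Finset.sum_insert (Finset.notMem_erase a S)]
      rw [Function.update_self, Finset.sum_update_of_notMem (Finset.notMem_erase a S)]
      intro h
      apply hz
      refine Finset.mem_image.2 ⟨S.erase a, ?_, ?_⟩
      · rw [Finset.mem_powerset]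
        intro i hi
        have := hS (Finset.mem_of_mem_erase hi)
        rcases Finset.mem_insert.1 this with h1 | h1
        · exact absurd h1 (Finset.ne_of_mem_erase hi)
        · exact h1
      · exact (eq_neg_of_add_eq_zero_left h).symm
    · rw [Finset.sum_update_of_notMem haS]
      refine hg S ?_ hne
      intro i hi
      rcases Finset.mem_insert.1 (hS hi) with h1 | h1
      · exact absurd (h1 ▸ hi) haS
      · exact h1

/-- Van der Waerden's theorem in infinite commutative rings, via Hales--Jewett. -/
lemma vdw_aux {D : Type*} [CommRing D] [Infinite D] (κ : Type*) [Finite κ]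
    (W : Finset D) :
    ∃ Bs As : Finset D, ∀ χ : D → κ, ∃ b ∈ Bs, ∃ a ∈ As, a ≠ 0 ∧
      ∃ k, ∀ w ∈ W, χ (b + a * w) = k := by
  classical
  obtain ⟨ι, hι, hHJ⟩ := Combinatorics.Line.exists_mono_in_high_dimension W κ
  obtain ⟨g, hg⟩ := exists_weights (D := D) (Finset.univ : Finset ι)
  let fb : (ι → Option W) → D := fun f => ∑ i, (match f i with | none => 0 | some w => g i * w)
  let fa : (ι → Option W) → D := fun f => ∑ i with f i = none, g i
  refine ⟨Finset.univ.image fb, Finset.univ.image fa, fun χ => ?_⟩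
  obtain ⟨L, k, hk⟩ := hHJ fun v => χ (∑ i, g i * (v i : D))
  refine ⟨fb L.idxFun, Finset.mem_image_of_mem _ (Finset.mem_univ _), fa L.idxFun,
    Finset.mem_image_of_mem _ (Finset.mem_univ _), ?_, k, fun w hw => ?_⟩
  · apply hg _ (Finset.subset_univ _)
    obtain ⟨i, hi⟩ := L.proper
    exact ⟨i, by simp [hi]⟩
  · rw [← hk ⟨w, hw⟩]
    congr 1
    simp only [fb, fa, Finset.sum_filter, Finset.sum_mul, ← Finset.sum_add_distrib]
    refine Finset.sum_congr rfl fun i _ => ?_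
    rcases h : L.idxFun i with _ | v <;> simp [h]

lemma vdw {D : Type*} [CommRing D] [Infinite D] (κ : Type*) [Finite κ]
    (W : Finset D) :
    ∃ Bs As : Finset D, ∀ χ : D → κ, ∃ b ∈ Bs, ∃ a ∈ As, a ≠ 0 ∧ b ≠ 0 ∧
      ∃ k, ∀ w ∈ W, χ (b + a * w) = k := by
  classical
  obtain ⟨Bs, As, h⟩ := vdw_aux (D := D) (κ × Bool) (insert 0 (insert 1 W))
  refine ⟨Bs, As, fun χ => ?_⟩
  obtain ⟨b, hb, a, ha, ha0, k, hk⟩ := h fun x => (χ x, decide (x = 0))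
  refine ⟨b, hb, a, ha, ha0, ?_, k.1, fun w hw => ?_⟩
  · rintro rfl
    have h0 := congrArg Prod.snd (hk 0 (by simp))
    have h1 := congrArg Prod.snd (hk 1 (by simp))
    rw [← h0] at h1
    simp [ha0] at h1
  · have h0 := congrArg Prod.fst (hk w (by simp [hw]))
    exact h0

/-- Row-wise monochromatic Deuber systems. -/
lemma deuber_rows {D : Type*} [CommRing D] [IsDomain D] [Infinite D] (κ : Type*) [Finite κ]
    (P : Finset D) (c : D) (hc : c ≠ 0) (M : ℕ) :
    ∃ W : Finset D, ∀ χ : D → κ, ∃ y : Fin M → D, (∀ t, y t ≠ 0) ∧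
      (∀ u : Fin M → D, (∀ s, u s ∈ P) → ∑ s, u s * y s ∈ W) ∧
      ∀ t, ∃ k, ∀ u : Fin M → D, (∀ s, u s ∈ P) → (∀ s ≤ t, u s = 0) →
        χ (c * y t + ∑ s, u s * y s) = k := by
  classical
  induction M with
  | zero => exact ⟨{0}, fun χ => ⟨0, fun t => t.elim0, by simp, fun t => t.elim0⟩⟩
  | succ M ih =>
    obtain ⟨W, hW⟩ := ih
    obtain ⟨Bs, As, hv⟩ := vdw (D := D) κ W
    refine ⟨((P ×ˢ Bs) ×ˢ (As ×ˢ W)).image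
      fun q => q.1.1 * q.1.2 + c * q.2.1 * q.2.2, fun χ => ?_⟩
    obtain ⟨b, hb, a, ha, ha0, hb0, k, hk⟩ := hv fun x => χ (c * x)
    obtain ⟨y, hy0, hyW, hyk⟩ := hW fun x => χ (c * a * x)
    have key : ∀ u : Fin (M + 1) → D,
        ∑ s, u s * (Fin.cons b (fun s => c * a * y s) : Fin (M + 1) → D) s
          = u 0 * b + c * a * ∑ s : Fin M, u s.succ * y s := by
      intro u
      rw [Fin.sum_univ_succ, Finset.mul_sum]
      simp only [Fin.cons_zero, Fin.cons_succ]
      congr 1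
      exact Finset.sum_congr rfl fun s _ => by ring
    refine ⟨Fin.cons b (fun s => c * a * y s), ?_, ?_, ?_⟩
    · intro t
      refine Fin.cases ?_ (fun t => ?_) t
      · simpa using hb0
      · simpa [hc, ha0] using hy0 t
    · intro u hu
      rw [key]
      refine Finset.mem_image.2 ⟨((u 0, b), (a, ∑ s : Fin M, u s.succ * y s)), ?_, rfl⟩
      simp only [Finset.mem_product]
      exact ⟨⟨hu 0, hb⟩, ha, hyW (fun s => u s.succ) fun s => hu _⟩
    · intro t
      refine Fin.cases ?_ (fun t => ?_) t
      · refine ⟨k, fun u hu hu0 => ?_⟩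
        rw [key, hu0 0 le_rfl, Fin.cons_zero, ← hk _ (hyW (fun s => u s.succ) fun s => hu _)]
        congr 1
        ring
      · obtain ⟨k', hk'⟩ := hyk t
        refine ⟨k', fun u hu hu0 => ?_⟩
        rw [key, hu0 0 (Fin.zero_le _), Fin.cons_succ,
          ← hk' (fun s => u s.succ) (fun s => hu _) fun s hs => hu0 _ (Fin.succ_le_succ_iff.2 hs)]
        congr 1
        ring

/-- Deuber's theorem for infinite domains. -/
lemma deuber {D : Type*} [CommRing D] [IsDomain D] [Infinite D] {κ : Type*} [Finite κ]
    (P : Finset D) (c : D) (hc : c ≠ 0) (m : ℕ) (χ : D → κ) :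
    ∃ y : Fin (m + 1) → D, (∀ t, y t ≠ 0) ∧ ∃ k, ∀ t, ∀ u : Fin (m + 1) → D,
      (∀ s, u s ∈ P) → (∀ s ≤ t, u s = 0) → χ (c * y t + ∑ s, u s * y s) = k := by
  classical
  cases nonempty_fintype κ
  obtain ⟨W, hW⟩ := deuber_rows (D := D) κ (insert 0 P) c hc (Fintype.card κ * m + 1)
  obtain ⟨y, hy0, -, hk⟩ := hW χ
  choose col hcol using hk
  obtain ⟨k, hk⟩ := Fintype.exists_lt_card_fiber_of_mul_lt_card (f := col) (n := m)
    (by simp)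
  obtain ⟨T, hT, hTc⟩ := Finset.exists_subset_card_eq (Nat.succ_le_of_lt hk)
  let σ := T.orderEmbOfFin hTc
  have hσ : ∀ t, col (σ t) = k := fun t => by
    have := hT (T.orderEmbOfFin_mem hTc t)
    simpa using this
  refine ⟨fun t => y (σ t), fun t => hy0 _, k, fun t u hu hu0 => ?_⟩
  rw [← hσ t, ← hcol (σ t) (Function.extend σ u 0)]
  · congr 2
    refine Fintype.sum_of_injective σ σ.injective _ _ ?_ ?_
    · intro i hi
      rw [Function.extend_apply' _ _ _ (by simpa using hi)]
      simp
    · intro i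
      rw [σ.injective.extend_apply]
  · intro s
    by_cases hs : ∃ i, σ i = s
    · obtain ⟨i, rfl⟩ := hs
      rw [σ.injective.extend_apply]
      exact Finset.mem_insert_of_mem (hu i)
    · rw [Function.extend_apply' _ _ _ hs]
      simp
  · intro s hst
    by_cases hs : ∃ i, σ i = s
    · obtain ⟨i, rfl⟩ := hs
      rw [σ.injective.extend_apply]
      exact hu0 i (σ.le_iff_le.1 hst)
    · rw [Function.extend_apply' _ _ _ hs]
      simp

/-- The columns condition in explicit form. -/
def CCond {D : Type*} [CommRing D] {k l : ℕ} (A : Matrix (Fin k) (Fin l) D) : Prop :=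
  ∃ (m : ℕ) (I : Fin (m + 1) → Finset (Fin l)) (d : Fin (m + 1) → D)
    (u : Fin (m + 1) → Fin l → D),
    (∀ t, (I t).Nonempty) ∧
    (∀ t t', t ≠ t' → Disjoint (I t) (I t')) ∧
    (∀ j : Fin l, ∃ t, j ∈ I t) ∧
    (∀ t, d t ≠ 0) ∧
    (∀ t j, (¬ ∃ t', t' < t ∧ j ∈ I t') → u t j = 0) ∧
    (∀ t i, d t * ∑ j ∈ I t, A i j = ∑ j, u t j * A i j) ∧
    (0 < m → Infinite D)

lemma CCond.isPRAll {D : Type*} [CommRing D] [IsDomain D] {k l : ℕ}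
    {A : Matrix (Fin k) (Fin l) D} (h : CCond A) : IsPRAll A D := by
  classical
  intro r _ χ
  obtain ⟨m, I, d, u, hne, hdis, hcov, hd, hu, hA, hinf⟩ := h
  have hc : ∏ t, d t ≠ 0 := Finset.prod_ne_zero_iff.2 fun t _ => hd t
  choose τ hτ using hcov
  have hτ' : ∀ t j, j ∈ I t ↔ t = τ j := by
    intro t j
    constructor
    · intro hj
      by_contra hne
      exact Finset.disjoint_left.1 (hdis _ _ hne) hj (hτ j)
    · rintro rfl
      exact hτ j
  let e : Fin (m + 1) → D := fun t => ∏ s ∈ Finset.univ.erase t, d s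
  have he : ∀ t, e t * d t = ∏ t, d t := fun t =>
    Finset.prod_erase_mul _ _ (Finset.mem_univ t)
  -- the solution vectors
  let w : Fin (m + 1) → Fin l → D := fun t j => - (e t * u t j)
  have hw0 : ∀ t j, t ≤ τ j → w t j = 0 := by
    intro t j htj
    simp only [w]
    rw [hu t j, mul_zero, neg_zero]
    rintro ⟨t', ht', hj⟩
    rw [hτ'] at hj
    subst hj
    exact absurd htj (not_le.2 ht')
  have hsol : ∀ t i, ∑ j, A i j * ((if t = τ j then ∏ t, d t else 0) + w t j) = 0 := by
    intro t i
    have h1 := hA t i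
    have h2 : ∑ j ∈ I t, A i j = ∑ j, if t = τ j then A i j else 0 := by
      rw [← Finset.sum_filter]
      congr 1
      ext j
      simp [hτ']
    calc ∑ j, A i j * ((if t = τ j then ∏ t, d t else 0) + w t j)
        = e t * (d t * ∑ j ∈ I t, A i j) - e t * ∑ j, u t j * A i j := by
          rw [h2, Finset.mul_sum, Finset.mul_sum, Finset.mul_sum, ← Finset.sum_sub_distrib]
          refine Finset.sum_congr rfl fun j _ => ?_
          simp only [w]
          rw [← he t]
          split_ifs <;> ring
      _ = 0 := by rw [h1, sub_self]
  have main : ∃ y : Fin (m + 1) → D, (∀ t, y t ≠ 0) ∧ ∃ k, ∀ j,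
      χ ((∏ t, d t) * y (τ j) + ∑ s, w s j * y s) = k := by
    rcases Nat.eq_zero_or_pos m with hm | hm
    · subst hm
      refine ⟨fun _ => 1, fun _ => one_ne_zero, χ ((∏ t, d t)), fun j => ?_⟩
      congr 1
      have : ∀ s, w s j = 0 := fun s => hw0 s j (by have h1 := s.2; have h2 := (τ j).2; rw [Fin.le_def]; omega)
      simp [this]
    · have := hinf hm
      obtain ⟨y, hy, k, hk⟩ := deuber (Finset.univ.image fun q : Fin (m + 1) × Fin l => w q.1 q.2)
        (∏ t, d t) hc m χ
      refine ⟨y, hy, k, fun j => hk _ (fun s => w s j) (fun s => ?_) fun s hs => hw0 s j hs⟩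
      exact Finset.mem_image.2 ⟨(s, j), Finset.mem_univ _, rfl⟩
  obtain ⟨y, hy, k, hk⟩ := main
  refine ⟨fun j => (∏ t, d t) * y (τ j) + ∑ s, w s j * y s, ?_, ?_, fun j j' => by rw [hk, hk]⟩
  · obtain ⟨j, hj⟩ := hne (Fin.last m)
    rw [hτ'] at hj
    intro h
    have h1 := congrFun h j
    have : ∀ s, w s j = 0 := fun s => hw0 s j (by rw [← hj]; exact Fin.le_last s)
    simp only [this, zero_mul, Finset.sum_const_zero, add_zero, Pi.zero_apply] at h1
    exact mul_ne_zero hc (hy _) h1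
  · intro i
    have : ∀ j, (∏ t, d t) * y (τ j) + ∑ s, w s j * y s
        = ∑ s, ((if s = τ j then ∏ t, d t else 0) + w s j) * y s := by
      intro j
      simp [add_mul, Finset.sum_add_distrib]
    simp only [this, smul_eq_mul, Finset.mul_sum]
    rw [Finset.sum_comm]
    refine Finset.sum_eq_zero fun s _ => ?_
    have hz : (∑ j, A i j * ((if s = τ j then ∏ t, d t else 0) + w s j)) * y s = 0 := by
      rw [hsol s i, zero_mul]
    refine Eq.trans ?_ hz
    rw [Finset.sum_mul]
    exact Finset.sum_congr rfl fun j _ => by ring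

/-- Over a local ring every module has a "leading digit" colouring. -/
lemma exists_digits (B : Type*) [CommRing B] [IsLocalRing B] (M : Type*) [AddCommGroup M]
    [Module B M] :
    ∃ (C : Flag (Submodule B M)) (V : M → C) (c : M → B ⧸ IsLocalRing.maximalIdeal B),
      (∀ x, x ≠ 0 → x ∉ (V x : Submodule B M)) ∧
      (∀ x y, x ≠ 0 → y ≠ 0 → V x < V y → x ∈ (V y : Submodule B M)) ∧
      (∀ x y, x ≠ 0 → y ≠ 0 → V x = V y → c x = c y → x - y ∈ (V x : Submodule B M)) := by
  classical
  obtain ⟨C⟩ : Nonempty (Flag (Submodule B M)) := inferInstance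
  have hbot : (⊥ : Submodule B M) ∈ C := C.bot_mem
  -- the largest member of the chain not containing `x`
  have hV : ∀ x : M, x ≠ 0 → ∃ N ∈ C, x ∉ N ∧ ∀ N' ∈ C, x ∉ N' → N' ≤ N := by
    intro x hx
    let S : Set (Submodule B M) := {N | N ∈ C ∧ x ∉ N}
    have hS : S.Nonempty := ⟨⊥, hbot, by simpa using hx⟩
    have hdir : DirectedOn (· ≤ ·) S := by
      intro N hN N' hN'
      rcases C.le_or_le hN.1 hN'.1 with h | h
      · exact ⟨N', hN', h, le_rfl⟩
      · exact ⟨N, hN, le_rfl, h⟩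
    refine ⟨sSup S, ?_, ?_, fun N' hN' hx' => le_sSup ⟨hN', hx'⟩⟩
    · rw [Flag.mem_iff_forall_le_or_ge]
      intro N hN
      by_cases hxN : x ∈ N
      · left
        refine sSup_le fun N' hN' => ?_
        rcases C.le_or_le hN hN'.1 with h | h
        · exact absurd (h hxN) hN'.2
        · exact h
      · exact Or.inr (le_sSup ⟨hN, hxN⟩)
    · rw [Submodule.mem_sSup_of_directed hS hdir]
      rintro ⟨N, hN, hxN⟩
      exact hN.2 hxN
  -- between `V` and the next member
  have hbetween : ∀ (x : M) (N : Submodule B M), N ∈ C → x ∉ N → (∀ N' ∈ C, x ∉ N' → N' ≤ N) →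
      ∀ J : Ideal B, J • Submodule.span B {x} ⊔ N ∈ C := by
    intro x N hN hxN hmax J
    rw [Flag.mem_iff_forall_le_or_ge]
    intro N' hN'
    by_cases hx' : x ∈ N'
    · left
      refine sup_le (Submodule.smul_le_right.trans ?_) ?_
      · rwa [Submodule.span_singleton_le_iff_mem]
      · rcases C.le_or_le hN hN' with h | h
        · exact h
        · exact absurd (h hx') hxN
    · exact Or.inr ((hmax N' hN' hx').trans le_sup_right)
  let V : M → C := fun x => if hx : x ≠ 0 then ⟨(hV x hx).choose, (hV x hx).choose_spec.1⟩
    else ⟨⊥, hbot⟩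
  have hV1 : ∀ x, x ≠ 0 → x ∉ (V x : Submodule B M) := fun x hx => by
    simp only [V, dif_pos hx]; exact (hV x hx).choose_spec.2.1
  have hV2 : ∀ x, x ≠ 0 → ∀ N' ∈ C, x ∉ N' → N' ≤ (V x : Submodule B M) := fun x hx => by
    simp only [V, dif_pos hx]; exact (hV x hx).choose_spec.2.2
  have hgen : ∀ x y, x ≠ 0 → y ≠ 0 → V x = V y → ∃ b : B, x - b • y ∈ (V x : Submodule B M) := by
    intro x y hx hy hxy
    have h1 := hbetween y (V y) (V y).2 (hV1 y hy) (hV2 y hy) ⊤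
    have h2 : x ∈ (⊤ : Ideal B) • Submodule.span B {y} ⊔ (V y : Submodule B M) := by
      by_contra hcon
      have h3 := hV2 x hx _ h1 hcon
      rw [hxy] at h3
      refine hV1 y hy (h3 (Submodule.mem_sup_left ?_))
      rw [Submodule.top_smul]
      exact Submodule.mem_span_singleton_self y
    rw [Submodule.top_smul, Submodule.mem_sup] at h2
    obtain ⟨z, hz, v, hv, rfl⟩ := h2
    obtain ⟨b, rfl⟩ := Submodule.mem_span_singleton.1 hz
    refine ⟨b, ?_⟩
    rw [hxy]
    simpa using hv
  have hmax : ∀ y, y ≠ 0 → ∀ b ∈ IsLocalRing.maximalIdeal B, b • y ∈ (V y : Submodule B M) := by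
    intro y hy b hb
    have h1 := hbetween y (V y) (V y).2 (hV1 y hy) (hV2 y hy) (IsLocalRing.maximalIdeal B)
    refine hV2 y hy _ h1 ?_ (Submodule.mem_sup_left
      (Submodule.smul_mem_smul hb (Submodule.mem_span_singleton_self y)))
    intro h2
    rw [Submodule.mem_sup] at h2
    obtain ⟨z, hz, v, hv, h3⟩ := h2
    rw [Submodule.mem_smul_span_singleton] at hz
    obtain ⟨a, ha, rfl⟩ := hz
    have h4 : (1 - a) • y ∈ (V y : Submodule B M) := by
      have : (1 - a) • y = v := by
        rw [sub_smul, one_smul, sub_eq_iff_eq_add, add_comm, h3]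
      rwa [this]
    have hu : IsUnit (1 - a) := by
      by_contra hcon
      have h5 : (1 - a) ∈ IsLocalRing.maximalIdeal B := hcon
      have h6 := Ideal.add_mem _ h5 ha
      rw [sub_add_cancel] at h6
      exact (Ideal.ne_top_iff_one _).1 (IsLocalRing.maximalIdeal.isMaximal B).ne_top h6
    exact hV1 y hy ((Submodule.smul_mem_iff_of_isUnit _ hu).1 h4)
  let rep : C → M := fun N => if h : ∃ x, x ≠ 0 ∧ V x = N then h.choose else 0
  have hrep : ∀ x, x ≠ 0 → rep (V x) ≠ 0 ∧ V (rep (V x)) = V x := by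
    intro x hx
    have h : ∃ x', x' ≠ 0 ∧ V x' = V x := ⟨x, hx, rfl⟩
    simp only [rep, dif_pos h]
    exact h.choose_spec
  have hb : ∀ x, ∃ b : B, x ≠ 0 → x - b • rep (V x) ∈ (V x : Submodule B M) := by
    intro x
    by_cases hx : x = 0
    · exact ⟨0, fun h => absurd hx h⟩
    · obtain ⟨b, hb⟩ := hgen x (rep (V x)) hx (hrep x hx).1 (hrep x hx).2.symm
      exact ⟨b, fun _ => hb⟩
  choose β hβ using hb
  refine ⟨C, V, fun x => Ideal.Quotient.mk _ (β x), hV1, ?_, ?_⟩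
  · intro x y hx hy hxy
    by_contra hcon
    have := hV2 x hx _ (V y).2 hcon
    exact absurd hxy (not_lt.2 this)
  · intro x y hx hy hxy hc
    have h1 : (β x - β y) • rep (V x) ∈ (V x : Submodule B M) := by
      have := hmax (rep (V x)) (hrep x hx).1 _ (Ideal.Quotient.eq.1 hc)
      rwa [(hrep x hx).2] at this
    have h2 := hβ x hx
    have h3 := hβ y hy
    rw [← hxy] at h3
    have h4 := Submodule.add_mem _ (Submodule.sub_mem _ h2 h3) h1
    convert h4 using 1
    rw [sub_smul]
    abel

/-- Ranks of a finite family in a linear order. -/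
lemma exists_rank {Γ : Type*} [LinearOrder Γ] {l : ℕ} (hl : 0 < l) (f : Fin l → Γ) :
    ∃ (m : ℕ) (g : Fin l → Fin (m + 1)), Function.Surjective g ∧
      ∀ i j, g i ≤ g j ↔ f i ≤ f j := by
  classical
  let s : Finset Γ := Finset.univ.image f
  have hs : s.Nonempty := ⟨f ⟨0, hl⟩, Finset.mem_image_of_mem _ (Finset.mem_univ _)⟩
  obtain ⟨m, hm⟩ := Nat.exists_eq_succ_of_ne_zero (Finset.card_pos.2 hs).ne'
  let e := s.orderIsoOfFin hm
  have hf : ∀ i, f i ∈ s := fun i => Finset.mem_image_of_mem _ (Finset.mem_univ _)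
  refine ⟨m, fun i => e.symm ⟨f i, hf i⟩, ?_, ?_⟩
  · intro t
    obtain ⟨i, -, hi⟩ := Finset.mem_image.1 (e t).2
    refine ⟨i, ?_⟩
    rw [OrderIso.symm_apply_eq]
    exact Subtype.ext hi
  · intro i j
    simp

lemma isJacobsonRing_int : IsJacobsonRing ℤ := by
  rw [isJacobsonRing_iff_prime_eq]
  intro P hP
  by_cases hb : P = ⊥
  · subst hb
    refine le_antisymm (fun x hx => ?_) Ideal.le_jacobson
    have h1 := Ideal.mem_jacobson_bot.1 hx x
    rw [Ideal.mem_bot]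
    rcases Int.isUnit_iff.1 h1 with h | h
    · have : x * x = 0 := by linarith
      simpa using this
    · nlinarith [mul_self_nonneg x]
  · have := hP.isMaximal hb
    exact Ideal.jacobson_eq_self_of_isMaximal

/-- A field which is of finite type over `ℤ` is finite. -/
lemma finite_of_finiteType_int (F : Type*) [Field F] (f : ℤ →+* F) (hf : f.FiniteType) :
    Finite F := by
  obtain rfl : f = algebraMap ℤ F := Subsingleton.elim _ _
  have := RingHom.finiteType_algebraMap.1 hf
  have := isJacobsonRing_int
  have hfin : Module.Finite ℤ F := finite_of_finite_type_of_isJacobsonRing ℤ F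
  have hninj : ¬ Function.Injective (algebraMap ℤ F) := by
    intro hinj
    have : Algebra.IsIntegral ℤ F := inferInstance
    exact Int.not_isField (isField_of_isIntegral_of_isField hinj (Field.toIsField F))
  obtain ⟨p, hp⟩ := CharP.exists F
  have hp0 : p ≠ 0 := by
    rintro rfl
    have : CharZero F := CharP.charP_to_charZero F
    exact hninj (by simpa using Int.cast_injective)
  have : NeZero p := ⟨hp0⟩
  let _ := ZMod.algebra F p
  have : Module.Finite (ZMod p) F := Module.Finite.of_restrictScalars_finite ℤ (ZMod p) F
  exact Module.finite_of_finite (ZMod p)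

/-- Local subrings with finite residue field. -/
lemma exists_local {K : Type*} [Field K] (S : Finset K) :
    ∃ B : LocalSubring K, (∀ a ∈ S, a ∈ B.toSubring) ∧
      Finite (B.toSubring ⧸ IsLocalRing.maximalIdeal B.toSubring) := by
  let A : Subalgebra ℤ K := Algebra.adjoin ℤ (S : Set K)
  have hA : Algebra.FiniteType ℤ A :=
    (Subalgebra.fg_iff_finiteType _).1 (Subalgebra.fg_adjoin_finset S)
  obtain ⟨P, hP⟩ := Ideal.exists_maximal A
  let A' : Subring K := A.toSubring
  let P' : Ideal A' := P
  have hP' : P'.IsMaximal := hP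
  refine ⟨LocalSubring.ofPrime A' P', fun a ha => ?_, ?_⟩
  · exact LocalSubring.le_ofPrime A' P' (Algebra.subset_adjoin ha : a ∈ A)
  · have e := IsLocalization.AtPrime.equivQuotMaximalIdeal P' (LocalSubring.ofPrime A' P').toSubring
    have : Finite (A ⧸ P) := by
      let _ := Ideal.Quotient.field P
      have : Algebra.FiniteType ℤ (A ⧸ P) :=
        Algebra.FiniteType.of_surjective (Ideal.Quotient.mkₐ ℤ P) (Ideal.Quotient.mkₐ_surjective ℤ P)
      exact finite_of_finiteType_int (A ⧸ P) (algebraMap ℤ (A ⧸ P))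
        (RingHom.finiteType_algebraMap.2 this)
    have : Finite (A' ⧸ P') := this
    exact Finite.of_equiv _ e.toEquiv

universe uK

lemma exists_colouring {K : Type uK} [Field K] (S : Finset K) :
    ∃ (F : Type uK) (_ : Finite F) (c : K → F), ∀ (l : ℕ) (x : Fin l → K), x ≠ 0 →
      (∀ j j', c (x j) = c (x j')) → ∃ (m : ℕ) (g : Fin l → Fin (m + 1)),
        Function.Surjective g ∧ ∀ a : Fin l → K, (∀ j, a j ∈ S) → ∑ j, a j * x j = 0 →
          ∀ t, (∀ j, g j < t → a j = 0) → ∑ j with g j = t, a j ≠ 1 := by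
  classical
  obtain ⟨B, hBS, hfin⟩ := exists_local S
  obtain ⟨C, V, c, hV1, hV2, hV3⟩ := exists_digits B.toSubring K
  refine ⟨_ × ULift.{uK} Bool, inferInstance, fun x => (c x, ⟨decide (x = 0)⟩), ?_⟩
  intro l x hx hmono
  obtain ⟨j₀, hj₀⟩ := Function.ne_iff.1 hx
  have hx0 : ∀ j, x j ≠ 0 := by
    intro j hj
    have := congrArg (fun q => q.2.down) (hmono j j₀)
    simp only [hj, decide_true] at this
    exact hj₀ (by simpa using this.symm)
  have hc : ∀ j j', c (x j) = c (x j') := fun j j' => congrArg Prod.fst (hmono j j')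
  obtain ⟨m, g, hg, hle⟩ := exists_rank (Fin.pos j₀) fun j => OrderDual.toDual (V (x j))
  refine ⟨m, g, hg, fun a ha hsum t ht hone => ?_⟩
  obtain ⟨j₁, hj₁⟩ := hg t
  have hVeq : ∀ j, g j = t → V (x j) = V (x j₁) := by
    intro j hj
    apply le_antisymm
    · exact (hle j₁ j).1 (by rw [hj, hj₁])
    · exact (hle j j₁).1 (by rw [hj, hj₁])
  have hsm : ∀ j, ∀ z ∈ (V (x j₁) : Submodule B.toSubring K), a j * z ∈
      (V (x j₁) : Submodule B.toSubring K) := fun j z hz =>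
    Submodule.smul_mem _ (⟨a j, hBS _ (ha j)⟩ : B.toSubring) hz
  have h1 : ∀ j, a j * x j - (if g j = t then a j else 0) * x j₁ ∈
      (V (x j₁) : Submodule B.toSubring K) := by
    intro j
    split_ifs with hj
    · rw [← mul_sub]
      apply hsm
      rw [← hVeq j hj]
      exact hV3 _ _ (hx0 _) (hx0 _) (hVeq j hj) (hc _ _)
    · rcases lt_or_gt_of_ne hj with h | h
      · simp [ht j h]
      · rw [zero_mul, sub_zero]
        apply hsm
        apply hV2 _ _ (hx0 _) (hx0 _)
        rw [← hj₁] at h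
        by_contra hcon
        exact absurd ((hle j j₁).2 (not_lt.1 hcon)) (not_le.2 h)
  have h2 := Submodule.sum_mem _ fun j (_ : j ∈ Finset.univ) => h1 j
  rw [Finset.sum_sub_distrib, hsum, ← Finset.sum_mul, ← Finset.sum_filter, hone, zero_sub,
    one_mul, Submodule.neg_mem_iff] at h2
  exact hV1 _ (hx0 _) h2

lemma isPRAll_field {K : Type*} [Field K] {k l : ℕ} {A : Matrix (Fin k) (Fin l) K}
    (h : IsPRAll A K) : CCond A := by
  classical
  by_cases hK : Finite K
  · obtain ⟨n, ⟨e⟩⟩ := Finite.exists_equiv_fin K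
    have hn : 1 ≤ n := Nat.one_le_iff_ne_zero.2 (by rintro rfl; exact (e 0).elim0)
    obtain ⟨x, hx, hsol, hmono⟩ := h n hn e
    obtain ⟨j₀, hj₀⟩ := Function.ne_iff.1 hx
    refine ⟨0, fun _ => Finset.univ, fun _ => x j₀, fun _ _ => 0, fun t => ⟨j₀, Finset.mem_univ _⟩,
      fun t t' h => absurd (Subsingleton.elim (α := Fin 1) t t') h, fun j => ⟨0, Finset.mem_univ _⟩,
      fun _ => hj₀, fun _ _ _ => rfl, fun t i => ?_, fun h => absurd h (lt_irrefl 0)⟩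
    have h1 := hsol i
    simp only [smul_eq_mul] at h1
    simp only [zero_mul, Finset.sum_const_zero]
    rw [← h1, Finset.mul_sum]
    refine Finset.sum_congr rfl fun j _ => ?_
    rw [e.injective (hmono j j₀), mul_comm]
  · have hinf : Infinite K := not_finite_iff_infinite.1 hK
    let col : Fin l → Fin k → K := fun j i => A i j
    -- separating functionals
    have hsep : ∀ q : Finset (Fin l) × Finset (Fin l), ∃ φ : (Fin k → K) →ₗ[K] K,
        (∑ j ∈ q.2, col j) ∉ Submodule.span K (col '' q.1) →
          (∀ j ∈ q.1, φ (col j) = 0) ∧ φ (∑ j ∈ q.2, col j) = 1 := by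
      intro q
      by_cases hq : (∑ j ∈ q.2, col j) ∈ Submodule.span K (col '' q.1)
      · exact ⟨0, fun h => absurd hq h⟩
      · obtain ⟨φ, hφ, hle⟩ := Submodule.exists_le_ker_of_notMem hq
        refine ⟨(φ (∑ j ∈ q.2, col j))⁻¹ • φ, fun _ => ⟨fun j hj => ?_, ?_⟩⟩
        · have : φ (col j) = 0 := hle (Submodule.subset_span ⟨j, hj, rfl⟩)
          simp [this]
        · rw [LinearMap.smul_apply, smul_eq_mul, inv_mul_cancel₀ hφ]
    choose φ hφ using hsep
    obtain ⟨F, hF, c, hc⟩ := exists_colouring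
      (Finset.univ.image fun q : (Finset (Fin l) × Finset (Fin l)) × Fin l => φ q.1 (col q.2))
    obtain ⟨n, ⟨e⟩⟩ := Finite.exists_equiv_fin F
    have hn : 1 ≤ n := Nat.one_le_iff_ne_zero.2 (by rintro rfl; exact (e (c 0)).elim0)
    obtain ⟨x, hx, hsol, hmono⟩ := h n hn fun z => e (c z)
    obtain ⟨m, g, hg, hcond⟩ := hc l x hx fun j j' => e.injective (hmono j j')
    have hspan : ∀ t, (∑ j with g j = t, col j) ∈
        Submodule.span K (col '' ((Finset.univ.filter fun j => g j < t : Finset (Fin l)) : Set (Fin l))) := by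
      intro t
      by_contra hcon
      obtain ⟨h1, h2⟩ := hφ (Finset.univ.filter fun j => g j < t, Finset.univ.filter fun j => g j = t)
        hcon
      refine hcond (fun j => φ _ (col j)) (fun j => Finset.mem_image.2 ⟨(_, j), Finset.mem_univ _, rfl⟩)
        ?_ t (fun j hj => h1 j (by simpa using hj)) ?_
      · have h3 : ∑ j, x j • col j = 0 := by
          ext i
          have := hsol i
          simpa [col, mul_comm] using this
        have h4 := congrArg (φ (Finset.univ.filter fun j => g j < t, Finset.univ.filter fun j => g j = t)) h3
        simpa [mul_comm] using h4
      · rw [map_sum] at h2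
        exact h2
    have hu : ∀ t, ∃ u : Fin l → K, (∀ j, ¬ g j < t → u j = 0) ∧
        ∑ j with g j = t, col j = ∑ j, u j • col j := by
      intro t
      obtain ⟨u, hu⟩ := (Submodule.mem_span_image_finset_iff_exists_fun' K).1 (hspan t)
      refine ⟨fun j => if g j < t then u j else 0, fun j hj => if_neg hj, ?_⟩
      rw [← hu, Finset.sum_filter]
      refine Finset.sum_congr rfl fun j _ => ?_
      simp only [ite_smul, zero_smul]
    choose u hu0 hu1 using hu
    refine ⟨m, fun t => Finset.univ.filter fun j => g j = t, fun _ => 1, u, fun t => ?_, ?_, ?_,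
      fun _ => one_ne_zero, ?_, ?_, fun _ => hinf⟩
    · obtain ⟨j, hj⟩ := hg t
      exact ⟨j, by simpa using hj⟩
    · intro t t' htt
      rw [Finset.disjoint_left]
      intro j hj hj'
      simp only [Finset.mem_filter, Finset.mem_univ, true_and] at hj hj'
      exact htt (hj.symm.trans hj')
    · intro j
      exact ⟨g j, by simp⟩
    · intro t j hj
      apply hu0
      intro hlt
      exact hj ⟨g j, hlt, by simp⟩
    · intro t i
      have := congrFun (hu1 t) i
      simpa [col] using this

lemma exists_annihilator {R : Type*} [CommRing R] [IsReduced R] [IsNoetherianRing R]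
    (p : Ideal R) (hp : p ∈ minimalPrimes R) : ∃ s : R, s ∉ p ∧ ∀ x ∈ p, s * x = 0 := by
  classical
  have hpp : p.IsPrime := hp.1.1
  have hfin : (minimalPrimes R).Finite := minimalPrimes.finite_of_isNoetherianRing R
  let T : Finset (Ideal R) := hfin.toFinset.erase p
  have h1 : ¬ T.inf id ≤ p := by
    intro h
    obtain ⟨q, hq, hqp⟩ := (Ideal.IsPrime.inf_le' hpp).1 h
    have hq1 := Finset.mem_erase.1 hq
    have hq2 : q ∈ minimalPrimes R := by simpa using hq1.2
    exact hq1.1 (le_antisymm hqp (hp.2 hq2.1 hqp))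
  obtain ⟨s, hs, hsp⟩ := SetLike.not_le_iff_exists.1 h1
  refine ⟨s, hsp, fun x hx => ?_⟩
  have h2 : s * x ∈ sInf (minimalPrimes R) := by
    rw [Ideal.mem_sInf]
    intro q hq
    by_cases hqp : q = p
    · subst hqp
      exact Ideal.mul_mem_left _ _ hx
    · refine Ideal.mul_mem_right _ _ ?_
      exact (Finset.inf_le (f := id) (Finset.mem_erase.2 ⟨hqp, by simpa using hq⟩) : T.inf id ≤ q) hs
  have h3 : sInf (minimalPrimes R) = ⊥ := by
    rw [minimalPrimes, Ideal.sInf_minimalPrimes]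
    exact nilradical_eq_zero R
  rw [h3] at h2
  simpa using h2

lemma exists_minimalPrime {R : Type*} [CommRing R] [IsReduced R] (x : R) (hx : x ≠ 0) :
    ∃ p ∈ minimalPrimes R, x ∉ p := by
  by_contra! hcon
  have h3 : sInf (minimalPrimes R) = ⊥ := by
    rw [minimalPrimes, Ideal.sInf_minimalPrimes]
    exact nilradical_eq_zero R
  apply hx
  have : x ∈ sInf (minimalPrimes R) := by
    rw [Ideal.mem_sInf]
    intro q hq
    exact hcon q hq
  rw [h3] at this
  simpa using this

/-- Lifting partition regularity from the quotient by a minimal prime. -/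
lemma isPRAll_of_quotient {R : Type*} [CommRing R] [IsReduced R] [IsNoetherianRing R]
    {k l : ℕ} {A : Matrix (Fin k) (Fin l) R} (p : Ideal R) (hp : p ∈ minimalPrimes R)
    (h : IsPRAll (A.map (Ideal.Quotient.mk p)) (R ⧸ p)) : IsPRAll A R := by
  have hpp : p.IsPrime := hp.1.1
  obtain ⟨s, hs, hsp⟩ := exists_annihilator p hp
  intro r hr χ
  let f : R ⧸ p → R := fun z => s * Quotient.out z
  have hf : ∀ z : R, f (Ideal.Quotient.mk p z) = s * z := by
    intro z
    have h1 : Ideal.Quotient.mk p (Quotient.out (Ideal.Quotient.mk p z)) = Ideal.Quotient.mk p z :=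
      Ideal.Quotient.mk_out _
    have h2 := hsp _ (Ideal.Quotient.eq.1 h1)
    rw [mul_sub, sub_eq_zero] at h2
    exact h2
  obtain ⟨x, hx, hsol, hmono⟩ := h r hr fun z => χ (f z)
  have hsurj : ∀ j, ∃ z, Ideal.Quotient.mk p z = x j := fun j => Ideal.Quotient.mk_surjective _
  choose z hz using hsurj
  refine ⟨fun j => f (x j), ?_, ?_, hmono⟩
  · obtain ⟨j, hj⟩ := Function.ne_iff.1 hx
    refine Function.ne_iff.2 ⟨j, ?_⟩
    rw [← hz j, hf]
    intro h0
    have h1 : s * z j ∈ p := by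
      rw [show s * z j = 0 from h0]; exact p.zero_mem
    rcases hpp.mem_or_mem h1 with h2 | h2
    · exact hs h2
    · apply hj
      rw [← hz j]
      exact Ideal.Quotient.eq_zero_iff_mem.2 h2
  · intro i
    have h1 := hsol i
    simp only [← hz, Matrix.map_apply, smul_eq_mul, ← map_mul, ← map_sum] at h1
    have h2 := hsp _ (Ideal.Quotient.eq_zero_iff_mem.1 h1)
    simp only [← hz, hf, smul_eq_mul]
    rw [← h2, Finset.mul_sum]
    exact Finset.sum_congr rfl fun j _ => by ring

/-- Partition regularity passes to some quotient by a minimal prime. -/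
lemma exists_quotient_isPRAll {R : Type*} [CommRing R] [IsReduced R] [IsNoetherianRing R]
    {k l : ℕ} {A : Matrix (Fin k) (Fin l) R} (h : IsPRAll A R) :
    ∃ p ∈ minimalPrimes R, IsPRAll (A.map (Ideal.Quotient.mk p)) (R ⧸ p) := by
  classical
  by_contra! hcon
  have hfin : Finite (minimalPrimes R) := minimalPrimes.finite_of_isNoetherianRing R
  have h1 : ∀ p : minimalPrimes R, ∃ (r : ℕ) (χ : R ⧸ p.1 → Fin r), ∀ m : Fin l → R ⧸ p.1, m ≠ 0 →
      (∀ i, ∑ j, Ideal.Quotient.mk p.1 (A i j) * m j = 0) → ¬ ∀ j j', χ (m j) = χ (m j') := by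
    intro p
    have := hcon p.1 p.2
    unfold IsPRAll IsPR at this
    push Not at this
    obtain ⟨r, -, χ, hχ⟩ := this
    refine ⟨r, χ, fun m hm hs hmono => ?_⟩
    obtain ⟨j, j', hj⟩ := hχ m hm hs
    exact hj (hmono j j')
  choose r χ hχ using h1
  obtain ⟨n, ⟨e⟩⟩ := Finite.exists_equiv_fin (∀ p : minimalPrimes R, Fin (r p))
  let c : R → Fin n := fun x => e fun p => χ p (Ideal.Quotient.mk p.1 x)
  have hn : 1 ≤ n := Nat.one_le_iff_ne_zero.2 (by rintro rfl; exact (c 0).elim0)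
  obtain ⟨m, hm, hsol, hmono⟩ := h n hn c
  obtain ⟨j, hj⟩ := Function.ne_iff.1 hm
  obtain ⟨p, hp, hjp⟩ := exists_minimalPrime (m j) hj
  refine hχ ⟨p, hp⟩ (fun j => Ideal.Quotient.mk p (m j)) ?_ ?_ ?_
  · refine Function.ne_iff.2 ⟨j, fun h0 => hjp (Ideal.Quotient.eq_zero_iff_mem.1 h0)⟩
  · intro i
    have := congrArg (Ideal.Quotient.mk p) (hsol i)
    simpa using this
  · intro j j'
    exact congrFun (e.injective (hmono j j')) ⟨p, hp⟩

lemma isPRAll_fractionRing {D : Type*} [CommRing D] [IsDomain D] {k l : ℕ}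
    {A : Matrix (Fin k) (Fin l) D} (h : IsPRAll A D) :
    IsPRAll (A.map (algebraMap D (FractionRing D))) (FractionRing D) := by
  intro r hr χ
  obtain ⟨m, hm, hsol, hmono⟩ := h r hr fun x => χ (algebraMap D (FractionRing D) x)
  refine ⟨fun j => algebraMap D (FractionRing D) (m j), ?_, ?_, hmono⟩
  · obtain ⟨j, hj⟩ := Function.ne_iff.1 hm
    refine Function.ne_iff.2 ⟨j, ?_⟩
    simpa using hj
  · intro i
    have := congrArg (algebraMap D (FractionRing D)) (hsol i)
    simpa using this

lemma ccond_of_fractionRing {D : Type*} [CommRing D] [IsDomain D] {k l : ℕ}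
    {A : Matrix (Fin k) (Fin l) D} (h : CCond (A.map (algebraMap D (FractionRing D)))) :
    CCond A := by
  obtain ⟨m, I, d, u, hne, hdis, hcov, hd, hu, hA, hinf⟩ := h
  obtain ⟨b, hb⟩ := IsLocalization.exist_integer_multiples_of_finite (nonZeroDivisors D)
    (Sum.elim d fun q : Fin (m + 1) × Fin l => u q.1 q.2)
  have hd' : ∀ t, ∃ z, algebraMap D (FractionRing D) z = (b : D) • d t := fun t => hb (Sum.inl t)
  have hu' : ∀ t j, ∃ z, algebraMap D (FractionRing D) z = (b : D) • u t j :=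
    fun t j => hb (Sum.inr (t, j))
  choose d' hd' using hd'
  choose u' hu' using hu'
  have hb0 : (b : D) ≠ 0 := nonZeroDivisors.coe_ne_zero b
  have hinj : Function.Injective (algebraMap D (FractionRing D)) :=
    IsFractionRing.injective D (FractionRing D)
  refine ⟨m, I, d', u', hne, hdis, hcov, fun t h0 => ?_, fun t j hj => ?_, fun t i => ?_, fun hm => ?_⟩
  · have := hd' t
    rw [h0, map_zero] at this
    exact (smul_ne_zero hb0 (hd t)) this.symm
  · apply hinj
    rw [hu', hu t j hj, smul_zero, map_zero]
  · apply hinj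
    have h1 := congrArg (fun z => (b : D) • z) (hA t i)
    simp only [Matrix.map_apply, Finset.smul_sum, ← smul_mul_assoc, ← hd', ← hu'] at h1
    simpa using h1
  · have := hinf hm
    by_contra hcon
    have : Finite D := not_infinite_iff_finite.1 hcon
    have hs := (IsFractionRing.surjective_iff_isField (R := D) (K := FractionRing D)).2
      (Finite.isField_of_domain D)
    have : Finite (FractionRing D) := Finite.of_surjective _ hs
    exact not_finite (FractionRing D)

/-- From the columns condition in a quotient to the generalised columns condition. -/
lemma genColumnsCondition_of_quotient {R : Type*} [CommRing R] [IsReduced R] [IsNoetherianRing R]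
    {k l : ℕ} {A : Matrix (Fin k) (Fin l) R} (p : Ideal R) (hp : p ∈ minimalPrimes R)
    (h : CCond (A.map (Ideal.Quotient.mk p))) : GenColumnsCondition A := by
  classical
  have hpp : p.IsPrime := hp.1.1
  obtain ⟨s, hs, hsp⟩ := exists_annihilator p hp
  obtain ⟨m, I, d, u, hne, hdis, hcov, hd, hu, hA, hinf⟩ := h
  choose d' hd' using fun t => Ideal.Quotient.mk_surjective (I := p) (d t)
  choose u' hu' using fun t j => Ideal.Quotient.mk_surjective (I := p) (u t j)
  have hs' : Ideal.Quotient.mk p s ≠ 0 := fun h => hs (Ideal.Quotient.eq_zero_iff_mem.1 h)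
  have hsd : ∀ t, Ideal.Quotient.mk p (s * d' t) ≠ 0 := fun t => by
    rw [map_mul, hd']
    exact mul_ne_zero hs' (hd t)
  have key : ∀ t i, s * d' t * ∑ j ∈ I t, A i j = ∑ j, s * u' t j * A i j := by
    intro t i
    have h1 : Ideal.Quotient.mk p (d' t * ∑ j ∈ I t, A i j) =
        Ideal.Quotient.mk p (∑ j, u' t j * A i j) := by
      have := hA t i
      simp only [map_mul, map_sum, hd', hu']
      simpa using this
    have h2 := hsp _ (Ideal.Quotient.eq.1 h1)
    rw [mul_sub, sub_eq_zero] at h2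
    rw [mul_assoc, h2, Finset.mul_sum]
    exact Finset.sum_congr rfl fun j _ => by ring
  have hsu : ∀ t j, (¬ ∃ t', t' < t ∧ j ∈ I t') → s * u' t j = 0 := by
    intro t j hj
    apply hsp
    rw [← Ideal.Quotient.eq_zero_iff_mem, hu', hu t j hj]
  refine ⟨m, I, fun t => s * d' t, hne, hdis, hcov, fun t h0 => hsd t ((congrArg _ h0).trans (map_zero _)),
    fun i => ?_, fun t ht => ?_, fun hm n => ?_⟩
  · rw [key]
    refine Finset.sum_eq_zero fun j _ => ?_
    rw [hsu 0 j (fun ⟨t', ht', _⟩ => absurd ht' (not_lt.2 (Fin.zero_le _))), zero_mul]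
  · have h1 : (fun i : Fin k => s * d' t * ∑ j ∈ I t, A i j) =
        ∑ j, (s * u' t j) • (fun i : Fin k => A i j) := by
      ext i
      rw [key]
      simp
    rw [h1]
    refine Submodule.sum_mem _ fun j _ => ?_
    by_cases hj : ∃ t', t' < t ∧ j ∈ I t'
    · exact Submodule.smul_mem _ _ (Submodule.subset_span ⟨j, hj, rfl⟩)
    · rw [hsu t j hj, zero_smul]
      exact Submodule.zero_mem _
  · have := hinf hm
    set q : R := s * d' 0 * (∏ t ∈ Finset.univ.filter (fun t => t ≠ 0), s * d' t) ^ n with hq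
    have hq0 : Ideal.Quotient.mk p q ≠ 0 := by
      rw [hq, map_mul, map_pow, map_prod]
      exact mul_ne_zero (hsd 0) (pow_ne_zero _ (Finset.prod_ne_zero_iff.2 fun t _ => hsd t))
    refine Set.Infinite.of_image (Ideal.Quotient.mk p) ?_
    have h2 : (Set.range fun z : R ⧸ p => Ideal.Quotient.mk p q * z).Infinite :=
      Set.infinite_range_of_injective (mul_right_injective₀ hq0)
    refine h2.mono ?_
    rintro _ ⟨z, rfl⟩
    obtain ⟨z, rfl⟩ := Ideal.Quotient.mk_surjective z
    exact ⟨q * z, ⟨z, rfl⟩, map_mul _ _ _⟩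

/-- From the generalised columns condition to the columns condition in some quotient. -/
lemma exists_quotient_ccond {R : Type*} [CommRing R] [IsReduced R] [IsNoetherianRing R]
    {k l : ℕ} {A : Matrix (Fin k) (Fin l) R} (h : GenColumnsCondition A) :
    ∃ p ∈ minimalPrimes R, CCond (A.map (Ideal.Quotient.mk p)) := by
  classical
  obtain ⟨m, I, d, hne, hdis, hcov, hd, hA0, hA, hinf⟩ := h
  have hp : ∃ p ∈ minimalPrimes R, (∀ t, d t ∉ p) ∧ (0 < m → Infinite (R ⧸ p)) := by
    rcases Nat.eq_zero_or_pos m with hm | hm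
    · subst hm
      obtain ⟨p, hp, h0⟩ := exists_minimalPrime (d 0) (hd 0)
      refine ⟨p, hp, fun t => ?_, fun h => absurd h (lt_irrefl 0)⟩
      rw [show t = 0 from Subsingleton.elim (α := Fin 1) t 0]
      exact h0
    · have h1 := hinf hm 1
      set e : R := d 0 * (∏ t ∈ Finset.univ.filter (fun t => t ≠ 0), d t) ^ 1 with he
      have hde : ∀ t, d t ∣ e := by
        intro t
        rw [he, pow_one]
        by_cases ht : t = 0
        · subst ht
          exact dvd_mul_right _ _
        · exact dvd_mul_of_dvd_right (Finset.dvd_prod_of_mem d (by simpa using ht)) _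
      have h2 : ∃ p ∈ minimalPrimes R, e ∉ p ∧ Infinite (R ⧸ p) := by
        by_contra! hcon
        have hfin : Finite (minimalPrimes R) := minimalPrimes.finite_of_isNoetherianRing R
        let f : R → ∀ p : minimalPrimes R, R ⧸ p.1 := fun x p => Ideal.Quotient.mk p.1 x
        have hf : Function.Injective f := by
          intro x y hxy
          by_contra hne
          obtain ⟨p, hp, hxp⟩ := exists_minimalPrime (x - y) (sub_ne_zero.2 hne)
          exact hxp (Ideal.Quotient.eq.1 (congrFun hxy ⟨p, hp⟩))
        refine (h1.image hf.injOn) ?_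
        refine Set.Finite.subset (Set.Finite.pi' (t := fun p : minimalPrimes R =>
          Set.range fun z : R ⧸ p.1 => Ideal.Quotient.mk p.1 e * z) fun p => ?_) ?_
        · by_cases hep : e ∈ p.1
          · rw [Ideal.Quotient.eq_zero_iff_mem.2 hep]
            refine Set.Finite.subset (Set.finite_singleton 0) ?_
            rintro _ ⟨z, rfl⟩
            simp
          · have h3 : Finite (R ⧸ p.1) := by
              simpa using hcon p.1 p.2 hep
            exact Set.toFinite _
        · rintro _ ⟨_, ⟨z, rfl⟩, rfl⟩ p
          exact ⟨Ideal.Quotient.mk p.1 z, (map_mul _ _ _).symm⟩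
      obtain ⟨p, hp, hep, hinf⟩ := h2
      exact ⟨p, hp, fun t ht => hep (Ideal.mem_of_dvd _ (hde t) ht), fun _ => hinf⟩
  obtain ⟨p, hp, hdp, hinf'⟩ := hp
  have hu : ∀ t, ∃ u : Fin l → R, (∀ j, (¬ ∃ t', t' < t ∧ j ∈ I t') → u j = 0) ∧
      ∀ i, d t * ∑ j ∈ I t, A i j = ∑ j, u j * A i j := by
    intro t
    by_cases ht : t = 0
    · subst ht
      exact ⟨0, fun _ _ => rfl, fun i => by rw [hA0]; simp⟩
    · have h1 := hA t (Fin.pos_iff_ne_zero.2 ht)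
      let T : Finset (Fin l) := Finset.univ.filter fun j => ∃ t', t' < t ∧ j ∈ I t'
      have hT : {j | ∃ t', t' < t ∧ j ∈ I t'} = (T : Set (Fin l)) := by
        ext j
        simp [T]
      rw [hT] at h1
      obtain ⟨u, hu⟩ := (Submodule.mem_span_image_finset_iff_exists_fun' R).1 h1
      refine ⟨fun j => if ∃ t', t' < t ∧ j ∈ I t' then u j else 0, fun j hj => if_neg hj, fun i => ?_⟩
      have h2 := congrFun hu i
      simp only [Finset.sum_apply, Pi.smul_apply, smul_eq_mul] at h2
      rw [← h2, Finset.sum_filter]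
      refine Finset.sum_congr rfl fun j _ => ?_
      simp only [ite_mul, zero_mul]
  choose u hu0 hu1 using hu
  refine ⟨p, hp, m, I, fun t => Ideal.Quotient.mk p (d t), fun t j => Ideal.Quotient.mk p (u t j),
    hne, hdis, hcov, fun t h0 => hdp t (Ideal.Quotient.eq_zero_iff_mem.1 h0), fun t j hj => ?_,
    fun t i => ?_, hinf'⟩
  · simp only [hu0 t j hj, map_zero]
  · have := congrArg (Ideal.Quotient.mk p) (hu1 t i)
    simpa using this

theorem isRadoRing_of_reduced_noetherian {R : Type*} [CommRing R]
    [IsReduced R] [IsNoetherianRing R] : IsRadoRing R := by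
  intro k l A
  constructor
  · intro h
    obtain ⟨p, hp, hPR⟩ := exists_quotient_isPRAll h
    have hpp : p.IsPrime := hp.1.1
    exact genColumnsCondition_of_quotient p hp
      (ccond_of_fractionRing (isPRAll_field (isPRAll_fractionRing hPR)))
  · intro h
    obtain ⟨p, hp, hC⟩ := exists_quotient_ccond h
    have hpp : p.IsPrime := hp.1.1
    exact isPRAll_of_quotient p hp hC.isPRAll
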